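/- Let X be a smooth simplicial set. For a simplicial differential k-form ω = {ω_Σ} on X, let ∫ω ∈ C^k(X; ℝ) be the real k-cochain defined on a k-simplex Σ by (∫ω)(Σ) = ∫_{Δ^k} ω_Σ. Then ∫ commutes with the differentials: ∫(dω) = d(∫ω), where on forms d is the simplex-wise exterior derivative d{ω_Σ} = {dω_Σ} and on cochains d is the simplicial coboundary (dα)(Σ) = Σ_{i=0}^{k+1} (-1)^i α(d_iΣ). Consequently ∫ sends closed forms to cocycles and exact forms to coboundaries, and induces a homomorphism H^k_DR(X) → H^k(X; ℝ) from the de Rham cohomology of X to the simplicial cohomology of X with real coefficients. -/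

import Mathlib

noncomputable section

open scoped BigOperators

/-- The topological `d`-simplex `Δ^d = {x ∈ ℝ^d | ∀ i, 0 ≤ xᵢ and ∑ xᵢ ≤ 1}`. -/
def TSimplex (d : ℕ) : Set (Fin d → ℝ) :=
  {x | (∀ i, 0 ≤ x i) ∧ ∑ i, x i ≤ 1}

/-- A map `σ : Δ^n → Δ^d` is smooth if it extends to a `C^∞` map from an open
neighborhood of `Δ^n` in `ℝ^n` into `ℝ^d`. -/
def IsSmoothSimplexMap {n d : ℕ} (σ : TSimplex n → TSimplex d) : Prop :=
  ∃ (U : Set (Fin n → ℝ)) (gext : (Fin n → ℝ) → (Fin d → ℝ)),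
    IsOpen U ∧ TSimplex n ⊆ U ∧ ContDiffOn ℝ (⊤ : ℕ∞) gext U ∧
      ∀ x : TSimplex n, gext x.1 = (σ x).1

/-- Barycentric coordinates of a point of `ℝ^m` (with respect to the standard simplex). -/
def bary {m : ℕ} (x : Fin m → ℝ) : Fin (m + 1) → ℝ :=
  Fin.cons (1 - ∑ i, x i) x

theorem bary_nonneg {m : ℕ} {x : Fin m → ℝ} (hx : x ∈ TSimplex m) (i : Fin (m + 1)) :
    0 ≤ bary x i := by
  induction i using Fin.cases with
  | zero => simpa [bary] using sub_nonneg.mpr hx.2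
  | succ j => simpa [bary] using hx.1 j

theorem sum_bary {m : ℕ} (x : Fin m → ℝ) : ∑ i, bary x i = 1 := by
  simp [bary, Fin.sum_cons]

/-- The ambient affine map `ℝ^m → ℝ^n` induced by a monotone map of vertex sets
`φ : [m] → [n]`; it sends the `i`-th vertex of `Δ^m` to the `φ i`-th vertex of `Δ^n`. -/
def affineAux {m n : ℕ} (φ : Fin (m + 1) →o Fin (n + 1)) (x : Fin m → ℝ) : Fin n → ℝ :=
  fun j => ∑ i ∈ Finset.univ.filter (fun i => φ i = j.succ), bary x i

theorem affineAux_mem {m n : ℕ} (φ : Fin (m + 1) →o Fin (n + 1)) (x : TSimplex m) :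
    affineAux φ x.1 ∈ TSimplex n := by
  obtain ⟨x, hx⟩ := x
  have h1 : ∑ i' : Fin (n + 1), ∑ i ∈ Finset.univ.filter (fun i => φ i = i'), bary x i = 1 := by
    rw [Finset.sum_fiberwise]; exact sum_bary x
  have h2 := Fin.sum_univ_succ
    (fun i' : Fin (n + 1) => ∑ i ∈ Finset.univ.filter (fun i => φ i = i'), bary x i)
  have h0 : 0 ≤ ∑ i ∈ Finset.univ.filter (fun i => φ i = (0 : Fin (n + 1))), bary x i :=
    Finset.sum_nonneg fun i _ => bary_nonneg hx i
  constructor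
  · intro j
    exact Finset.sum_nonneg fun i _ => bary_nonneg hx i
  · show ∑ j : Fin n, affineAux φ x j ≤ 1
    have : ∑ j : Fin n, affineAux φ x j
        = ∑ j : Fin n, ∑ i ∈ Finset.univ.filter (fun i => φ i = j.succ), bary x i := rfl
    rw [this]
    rw [h2] at h1
    linarith

/-- The affine simplicial map `Δ^m → Δ^n` induced by a monotone map of vertices. -/
def affineMap {m n : ℕ} (φ : Fin (m + 1) →o Fin (n + 1)) (x : TSimplex m) : TSimplex n :=
  ⟨affineAux φ x.1, affineAux_mem φ x⟩

theorem contDiff_bary {m : ℕ} (i : Fin (m + 1)) :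
    ContDiff ℝ (⊤ : ℕ∞) fun x : Fin m → ℝ => bary x i := by
  induction i using Fin.cases with
  | zero =>
      simp only [bary, Fin.cons_zero]
      exact contDiff_const.sub (ContDiff.sum fun j _ =>
        (ContinuousLinearMap.proj j : (Fin m → ℝ) →L[ℝ] ℝ).contDiff)
  | succ j =>
      simp only [bary, Fin.cons_succ]
      exact (ContinuousLinearMap.proj j : (Fin m → ℝ) →L[ℝ] ℝ).contDiff

theorem contDiff_affineAux {m n : ℕ} (φ : Fin (m + 1) →o Fin (n + 1)) :
    ContDiff ℝ (⊤ : ℕ∞) (affineAux φ) := by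
  rw [contDiff_pi]
  intro j
  exact ContDiff.sum fun i _ => contDiff_bary i

/-- Affine simplicial maps are smooth maps of simplices. -/
theorem isSmooth_affineMap {m n : ℕ} (φ : Fin (m + 1) →o Fin (n + 1)) :
    IsSmoothSimplexMap (affineMap φ) :=
  ⟨Set.univ, affineAux φ, isOpen_univ, Set.subset_univ _,
    (contDiff_affineAux φ).contDiffOn, fun _ => rfl⟩

/-- The identity is a smooth map of simplices. -/
theorem isSmooth_id {n : ℕ} : IsSmoothSimplexMap (id : TSimplex n → TSimplex n) :=
  ⟨Set.univ, id, isOpen_univ, Set.subset_univ _, contDiffOn_id, fun _ => rfl⟩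

/-- Constant maps of simplices are smooth. -/
theorem isSmooth_const {k d : ℕ} (y : TSimplex d) :
    IsSmoothSimplexMap (fun _ : TSimplex k => y) :=
  ⟨Set.univ, fun _ => y.1, isOpen_univ, Set.subset_univ _, contDiffOn_const, fun _ => rfl⟩

/-- Composition of smooth maps of simplices is smooth. -/
theorem IsSmoothSimplexMap.comp {j k n : ℕ} {σ : TSimplex k → TSimplex n}
    {ρ : TSimplex j → TSimplex k} (hσ : IsSmoothSimplexMap σ) (hρ : IsSmoothSimplexMap ρ) :
    IsSmoothSimplexMap (σ ∘ ρ) := by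
  obtain ⟨U, g, hUo, hUs, hg, hgval⟩ := hσ
  obtain ⟨V, h, hVo, hVs, hh, hhval⟩ := hρ
  refine ⟨V ∩ h ⁻¹' U, g ∘ h, ?_, ?_, ?_, ?_⟩
  · exact hh.continuousOn.isOpen_inter_preimage hVo hUo
  · intro x hx
    refine ⟨hVs hx, ?_⟩
    show h x ∈ U
    have hx' : h x = (ρ ⟨x, hx⟩).1 := hhval ⟨x, hx⟩
    rw [hx']
    exact hUs (ρ ⟨x, hx⟩).2
  · exact hg.comp (hh.mono Set.inter_subset_left) fun x hx => hx.2
  · intro x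
    show g (h x.1) = (σ (ρ x)).1
    rw [hhval x]
    exact hgval (ρ x)

theorem affineAux_id {n : ℕ} (x : Fin n → ℝ) :
    affineAux (OrderHom.id : Fin (n + 1) →o Fin (n + 1)) x = x := by
  funext j
  show ∑ i ∈ Finset.univ.filter (fun i : Fin (n + 1) => i = j.succ), bary x i = x j
  rw [Finset.filter_eq']
  simp [bary]

theorem affineMap_id {n : ℕ} :
    affineMap (OrderHom.id : Fin (n + 1) →o Fin (n + 1)) = id := by
  funext x
  exact Subtype.ext (affineAux_id x.1)

theorem bary_affineAux {m n : ℕ} (φ : Fin (m + 1) →o Fin (n + 1)) (x : Fin m → ℝ)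
    (i' : Fin (n + 1)) :
    bary (affineAux φ x) i' = ∑ i ∈ Finset.univ.filter (fun i => φ i = i'), bary x i := by
  induction i' using Fin.cases with
  | zero =>
      have h1 : ∑ i'' : Fin (n + 1), ∑ i ∈ Finset.univ.filter (fun i => φ i = i''), bary x i
          = 1 := by rw [Finset.sum_fiberwise]; exact sum_bary x
      rw [Fin.sum_univ_succ] at h1
      have hz : bary (affineAux φ x) 0 = 1 - ∑ i, affineAux φ x i := rfl
      have hs : ∑ j : Fin n, affineAux φ x j
          = ∑ j : Fin n, ∑ i ∈ Finset.univ.filter (fun i => φ i = j.succ), bary x i := rfl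
      rw [hz, hs]
      linarith
  | succ j =>
      simp [bary, affineAux]

theorem affineAux_comp {j k n : ℕ} (φ : Fin (j + 1) →o Fin (k + 1))
    (ψ : Fin (k + 1) →o Fin (n + 1)) (x : Fin j → ℝ) :
    affineAux (ψ.comp φ) x = affineAux ψ (affineAux φ x) := by
  funext l
  have step1 : affineAux ψ (affineAux φ x) l
      = ∑ i' ∈ Finset.univ.filter (fun i' => ψ i' = l.succ),
          ∑ i ∈ Finset.univ.filter (fun i => φ i = i'), bary x i := by
    unfold affineAux
    exact Finset.sum_congr rfl fun i' _ => bary_affineAux φ x i'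
  rw [step1]
  have step2 : ∑ i' ∈ Finset.univ.filter (fun i' => ψ i' = l.succ),
      ∑ i ∈ Finset.univ.filter (fun i => φ i = i'), bary x i
      = ∑ i' ∈ Finset.univ.filter (fun i' => ψ i' = l.succ),
          ∑ i : Fin (j + 1), if φ i = i' then bary x i else 0 := by
    refine Finset.sum_congr rfl fun i' _ => ?_
    rw [Finset.sum_filter]
  rw [step2, Finset.sum_comm]
  have step3 : ∀ i : Fin (j + 1),
      (∑ i' ∈ Finset.univ.filter (fun i' => ψ i' = l.succ), if φ i = i' then bary x i else 0)
      = if ψ (φ i) = l.succ then bary x i else 0 := by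
    intro i
    rw [Finset.sum_ite_eq]
    simp
  rw [Finset.sum_congr rfl fun i _ => step3 i]
  rw [← Finset.sum_filter]
  rfl

theorem affineMap_comp {j k n : ℕ} (φ : Fin (j + 1) →o Fin (k + 1))
    (ψ : Fin (k + 1) →o Fin (n + 1)) :
    affineMap (ψ.comp φ) = affineMap ψ ∘ affineMap φ := by
  funext x
  exact Subtype.ext (affineAux_comp φ ψ x.1)

/-- A simplicial set: a contravariant functor from the simplex category (encoded via
monotone maps of the vertex sets `[n] = Fin (n+1)`) to sets. -/
structure SSetD where
  obj : ℕ → Type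
  map : ∀ (m n : ℕ), (Fin (m + 1) →o Fin (n + 1)) → obj n → obj m
  map_id : ∀ (n : ℕ) (x : obj n), map n n OrderHom.id x = x
  map_comp : ∀ (j k n : ℕ) (φ : Fin (j + 1) →o Fin (k + 1)) (ψ : Fin (k + 1) →o Fin (n + 1))
      (x : obj n), map j n (ψ.comp φ) x = map j k φ (map k n ψ x)

/-- A smooth simplicial set: a simplicial set `X` together with, for each `n`-simplex
`Σ ∈ X(n)`, a simplicial map `Σ_* = g(Σ) : Δ^n_• → X` (encoded by its values
`g n k Σ σ hσ ∈ X(k)` on the smooth `k`-simplices `σ` of `Δ^n_•`) such that `Σ_*`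
restricts to `Σ` on `Δ^n_simp` (`g_restrict`), is simplicial (`g_simplicial`), and
satisfies push-forward functoriality `(Σ_*(σ))_* = Σ_* ∘ σ_•` (`g_push`). -/
structure SmoothSSet extends SSetD where
  g : ∀ (n k : ℕ), obj n → ∀ σ : TSimplex k → TSimplex n, IsSmoothSimplexMap σ → obj k
  g_simplicial : ∀ (n k m : ℕ) (S : obj n) (σ : TSimplex k → TSimplex n)
      (hσ : IsSmoothSimplexMap σ) (φ : Fin (m + 1) →o Fin (k + 1)),
      g n m S (σ ∘ affineMap φ) (hσ.comp (isSmooth_affineMap φ)) = map m k φ (g n k S σ hσ)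
  g_restrict : ∀ (n k : ℕ) (S : obj n) (φ : Fin (k + 1) →o Fin (n + 1)),
      g n k S (affineMap φ) (isSmooth_affineMap φ) = map k n φ S
  g_push : ∀ (n k m : ℕ) (S : obj n) (σ : TSimplex k → TSimplex n) (hσ : IsSmoothSimplexMap σ)
      (ρ : TSimplex m → TSimplex k) (hρ : IsSmoothSimplexMap ρ),
      g k m (g n k S σ hσ) ρ hρ = g n m S (σ ∘ ρ) (hσ.comp hρ)

/-- A smooth map of smooth simplicial sets: a simplicial map `f` such that
`(f(Σ))_* = f ∘ Σ_*` for every simplex `Σ`. -/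
structure SmoothHom (X Y : SmoothSSet) where
  toFun : ∀ (n : ℕ), X.obj n → Y.obj n
  map_simplicial : ∀ (m n : ℕ) (φ : Fin (m + 1) →o Fin (n + 1)) (x : X.obj n),
      toFun m (X.map m n φ x) = Y.map m n φ (toFun n x)
  map_smooth : ∀ (n k : ℕ) (S : X.obj n) (σ : TSimplex k → TSimplex n)
      (hσ : IsSmoothSimplexMap σ),
      toFun k (X.g n k S σ hσ) = Y.g n k (toFun n S) σ hσ

theorem SmoothHom.ext' {X Y : SmoothSSet} {f g : SmoothHom X Y} (h : f.toFun = g.toFun) :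
    f = g := by
  cases f; cases g; cases h; rfl

/-- The set of smooth `k`-simplices of `Δ^d_•`, i.e. smooth maps `Δ^k → Δ^d`. -/
def SmoothSimplexMapT (k d : ℕ) : Type :=
  {σ : TSimplex k → TSimplex d // IsSmoothSimplexMap σ}

/-- The tautological smooth simplicial set `Δ^d_•`: its `k`-simplices are the smooth maps
`Δ^k → Δ^d`, the simplicial structure maps are given by precomposition with affine
simplicial maps, and the smooth structure is `g(Σ)(σ) = Σ ∘ σ`. -/
def DeltaBullet (d : ℕ) : SmoothSSet where
  obj k := SmoothSimplexMapT k d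
  map m n φ σ := ⟨σ.1 ∘ affineMap φ, σ.2.comp (isSmooth_affineMap φ)⟩
  map_id n σ := Subtype.ext (by show σ.1 ∘ affineMap OrderHom.id = σ.1; rw [affineMap_id]; rfl)
  map_comp j k n φ ψ σ := Subtype.ext
    (by show σ.1 ∘ affineMap (ψ.comp φ) = (σ.1 ∘ affineMap ψ) ∘ affineMap φ
        rw [affineMap_comp, Function.comp_assoc])
  g n k S σ hσ := ⟨S.1 ∘ σ, S.2.comp hσ⟩
  g_simplicial n k m S σ hσ φ := Subtype.ext (Function.comp_assoc S.1 σ (affineMap φ)).symm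
  g_restrict n k S φ := rfl
  g_push n k m S σ hσ ρ hρ := Subtype.ext (Function.comp_assoc S.1 σ ρ)

open MeasureTheory

/-- The `i`-th affine face inclusion `δ_i : Δ^m → Δ^{m+1}` as a morphism of the simplex
category: the order embedding `Fin.succAbove i` skipping the `i`-th vertex. -/
def faceHom {m : ℕ} (i : Fin (m + 2)) : Fin (m + 1) →o Fin (m + 2) :=
  (Fin.succAboveOrderEmb i).toOrderHom

/-- The value of the exterior derivative `dω` of a `k`-form `ω` on `ℝ^d` at `x` on the
vectors `v_0, …, v_k`:
`dω_x(v_0, …, v_k) = ∑ i, (-1)^i (Dω_x(v_i))(v_0, …, v̂_i, …, v_k)`. -/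
def extDerEval {d k : ℕ} (ω : (Fin d → ℝ) → ((Fin d → ℝ) [×k]→L[ℝ] ℝ))
    (x : Fin d → ℝ) (v : Fin (k + 1) → (Fin d → ℝ)) : ℝ :=
  ∑ i : Fin (k + 1), (-1 : ℝ) ^ (i : ℕ) *
    (fderiv ℝ ω x (v i)) (fun l : Fin k => v (i.succAbove l))

/-- A simplicial differential `k`-form on a smooth simplicial set `X`: for each
`d`-simplex `Σ` of `X`, a smooth `k`-form `ω_Σ` on (a neighborhood of) `Δ^d` (a `C^∞`
map to the alternating `k`-linear maps `(ℝ^d)^k → ℝ`), compatible with pullback along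
the affine face inclusions: `ĩ^* ω_{Σ₂} = ω_{Σ₁}` whenever `Σ₁ = X(ĩ)(Σ₂)` for an
injective morphism `ĩ` of the simplex category. -/
structure SimpForm (X : SmoothSSet) (k : ℕ) where
  form : ∀ (d : ℕ), X.obj d → (Fin d → ℝ) → ((Fin d → ℝ) [×k]→L[ℝ] ℝ)
  alternating : ∀ (d : ℕ) (S : X.obj d) (x : Fin d → ℝ) (v : Fin k → (Fin d → ℝ))
      (i j : Fin k), i ≠ j → v i = v j → form d S x v = 0
  smooth : ∀ (d : ℕ) (S : X.obj d), ∃ U : Set (Fin d → ℝ),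
      IsOpen U ∧ TSimplex d ⊆ U ∧ ContDiffOn ℝ (⊤ : ℕ∞) (form d S) U
  compat : ∀ (m d : ℕ) (ι : Fin (m + 1) →o Fin (d + 1)), Function.Injective ⇑ι →
      ∀ (S : X.obj d) (x : Fin m → ℝ), x ∈ TSimplex m → ∀ v : Fin k → (Fin m → ℝ),
        form m (X.map m d ι S) x v
          = form d S (affineAux ι x) (fun l => fderiv ℝ (affineAux ι) x (v l))

/-- The real `k`-cochain `∫ω` associated to a simplicial differential `k`-form `ω`:
`(∫ω)(Σ) = ∫_{Δ^k} ω_Σ`, integrating the top-degree form by evaluating on the standard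
basis of `ℝ^k` against Lebesgue measure. -/
def integCochain (X : SmoothSSet) (k : ℕ) (ω : SimpForm X k) : X.obj k → ℝ :=
  fun S => ∫ x in TSimplex k, ω.form k S x (fun l : Fin k => Pi.single l 1)

/-- The simplicial coboundary of a real `k`-cochain:
`(dα)(Σ) = ∑_{i=0}^{k+1} (-1)^i α(d_iΣ)`. -/
def cobdry (X : SmoothSSet) (k : ℕ) (α : X.obj k → ℝ) : X.obj (k + 1) → ℝ :=
  fun S => ∑ i : Fin (k + 2), (-1 : ℝ) ^ (i : ℕ) * α (X.map k (k + 1) (faceHom i) S)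

/-- A simplicial differential form is closed if its simplex-wise exterior derivative
vanishes on the simplices. -/
def FormClosed {X : SmoothSSet} {k : ℕ} (ω : SimpForm X k) : Prop :=
  ∀ (d : ℕ) (S : X.obj d) (x : Fin d → ℝ), x ∈ TSimplex d →
    ∀ v : Fin (k + 1) → (Fin d → ℝ), extDerEval (ω.form d S) x v = 0

/-- `ω = dη`: the `(k+1)`-form `ω` is the simplex-wise exterior derivative of the
`k`-form `η` (so `ω` is exact). -/
def FormDeriv {X : SmoothSSet} {k : ℕ} (η : SimpForm X k) (ω : SimpForm X (k + 1)) : Prop :=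
  ∀ (d : ℕ) (S : X.obj d) (x : Fin d → ℝ), x ∈ TSimplex d →
    ∀ v : Fin (k + 1) → (Fin d → ℝ), ω.form d S x v = extDerEval (η.form d S) x v

theorem insertNth_mem_TSimplex_iff {k : ℕ} (i : Fin (k + 1)) (t : ℝ) (y : Fin k → ℝ) :
    i.insertNth (α := fun _ => ℝ) t y ∈ TSimplex (k + 1) ↔
      y ∈ TSimplex k ∧ t ∈ Set.Icc 0 (1 - ∑ j, y j) := by
  simp only [TSimplex, Set.mem_ofPred_eq, Fin.forall_iff_succAbove i, Fin.sum_univ_succAbove _ i,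
    Fin.insertNth_apply_same, Fin.insertNth_apply_succAbove, Set.mem_Icc]
  constructor
  · rintro ⟨⟨h0, h1⟩, h2⟩
    exact ⟨⟨h1, by linarith⟩, h0, by linarith⟩
  · rintro ⟨⟨h1, -⟩, h0, h2⟩
    exact ⟨⟨h0, h1⟩, by linarith⟩

theorem isClosed_TSimplex (d : ℕ) : IsClosed (TSimplex d) := by
  have h : TSimplex d = (⋂ i, {x | 0 ≤ x i}) ∩ {x | ∑ i, x i ≤ 1} := by
    ext x
    simp [TSimplex]
  rw [h]
  exact (isClosed_iInter fun i => isClosed_le continuous_const (continuous_apply i)).inter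
    (isClosed_le (by fun_prop) continuous_const)

theorem isCompact_TSimplex (d : ℕ) : IsCompact (TSimplex d) := by
  refine (isCompact_Icc (a := (0 : Fin d → ℝ)) (b := 1)).of_isClosed_subset
    (isClosed_TSimplex d) fun x hx => ⟨hx.1, fun i => ?_⟩
  exact (Finset.single_le_sum (fun j _ => hx.1 j) (Finset.mem_univ i)).trans hx.2

theorem continuous_insertNth {k : ℕ} (i : Fin (k + 1)) :
    Continuous fun p : ℝ × (Fin k → ℝ) => i.insertNth (α := fun _ => ℝ) p.1 p.2 :=
  Continuous.finInsertNth (A := fun _ => ℝ) i continuous_fst continuous_snd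

theorem sum_nonneg_of_mem_TSimplex {k : ℕ} {y : Fin k → ℝ} (hy : y ∈ TSimplex k) :
    (0 : ℝ) ≤ 1 - ∑ j, y j :=
  sub_nonneg.mpr hy.2

/-- Fubini on the simplex, integrating the `i`-th coordinate first. -/
theorem setIntegral_TSimplex_succ {k : ℕ} (i : Fin (k + 1)) {F : (Fin (k + 1) → ℝ) → ℝ}
    (hF : IntegrableOn F (TSimplex (k + 1))) :
    ∫ x in TSimplex (k + 1), F x =
      ∫ y in TSimplex k, ∫ t in (0 : ℝ)..(1 - ∑ j, y j), F (i.insertNth t y) := by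
  have hm := (isClosed_TSimplex (k + 1)).measurableSet
  have hmp := (volume_preserving_piFinSuccAbove (fun _ => ℝ) i).symm
  have hint : Integrable (fun p : ℝ × (Fin k → ℝ) =>
      (TSimplex (k + 1)).indicator F (i.insertNth (α := fun _ => ℝ) p.1 p.2)) :=
    (hmp.integrable_comp_emb (MeasurableEquiv.measurableEmbedding _)).mpr
      ((integrable_indicator_iff hm).mpr hF)
  rw [← integral_indicator hm, ← hmp.integral_comp (MeasurableEquiv.measurableEmbedding _)]
  refine (integral_prod_symm _ hint).trans ?_
  rw [← integral_indicator (isClosed_TSimplex k).measurableSet]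
  refine integral_congr_ae (Filter.Eventually.of_forall fun y => ?_)
  by_cases hy : y ∈ TSimplex k
  · simp only [Set.indicator_of_mem hy]
    rw [intervalIntegral.integral_of_le (sum_nonneg_of_mem_TSimplex hy),
      ← integral_Icc_eq_integral_Ioc, ← integral_indicator measurableSet_Icc]
    refine integral_congr_ae (Filter.Eventually.of_forall fun t => ?_)
    by_cases ht : t ∈ Set.Icc 0 (1 - ∑ j, y j)
    · simp only [Set.indicator_of_mem ht]
      exact Set.indicator_of_mem ((insertNth_mem_TSimplex_iff i t y).mpr ⟨hy, ht⟩) F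
    · simp only [Set.indicator_of_notMem ht]
      exact Set.indicator_of_notMem
        (fun h => ht ((insertNth_mem_TSimplex_iff i t y).mp h).2) F
  · simp only [Set.indicator_of_notMem hy]
    refine integral_eq_zero_of_ae (Filter.Eventually.of_forall fun t => ?_)
    exact Set.indicator_of_notMem
      (fun h => hy ((insertNth_mem_TSimplex_iff i t y).mp h).1) F

theorem hasDerivAt_insertNth {k : ℕ} (i : Fin (k + 1)) (y : Fin k → ℝ) (t : ℝ) :
    HasDerivAt (fun s : ℝ => (i.insertNth (α := fun _ => ℝ) s y : Fin (k + 1) → ℝ))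
      (Pi.single i 1) t := by
  rw [hasDerivAt_pi, Fin.forall_iff_succAbove i]
  refine ⟨by simpa using hasDerivAt_id' t, fun j => ?_⟩
  simpa using hasDerivAt_const t (y j)

theorem continuousOn_fderiv_apply {d : ℕ} {f : (Fin d → ℝ) → ℝ} {U : Set (Fin d → ℝ)}
    (hU : IsOpen U) (hf : ContDiffOn ℝ (⊤ : ℕ∞) f U) (v : Fin d → ℝ) :
    ContinuousOn (fun x => fderiv ℝ f x v) U :=
  (hf.continuousOn_fderiv_of_isOpen hU (by simp)).clm_apply continuousOn_const

/-- The integral of a partial derivative over the simplex is the difference of the integrals over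
the two faces crossed by the corresponding coordinate direction. -/
theorem setIntegral_TSimplex_fderiv {k : ℕ} (i : Fin (k + 1)) {f : (Fin (k + 1) → ℝ) → ℝ}
    {U : Set (Fin (k + 1) → ℝ)} (hU : IsOpen U) (hs : TSimplex (k + 1) ⊆ U)
    (hf : ContDiffOn ℝ (⊤ : ℕ∞) f U) :
    ∫ x in TSimplex (k + 1), fderiv ℝ f x (Pi.single i 1) =
      (∫ y in TSimplex k, f (i.insertNth (1 - ∑ j, y j) y)) -
        ∫ y in TSimplex k, f (i.insertNth 0 y) := by
  have hc := continuousOn_fderiv_apply hU hf (Pi.single i 1)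
  rw [setIntegral_TSimplex_succ i ((hc.mono hs).integrableOn_compact (isCompact_TSimplex _)),
    ← integral_sub]
  · refine setIntegral_congr_fun (isClosed_TSimplex k).measurableSet fun y hy => ?_
    have hmem : ∀ t ∈ Set.uIcc 0 (1 - ∑ j, y j),
        i.insertNth (α := fun _ => ℝ) t y ∈ U := fun t ht =>
      hs ((insertNth_mem_TSimplex_iff i t y).mpr
        ⟨hy, by rwa [Set.uIcc_of_le (sum_nonneg_of_mem_TSimplex hy)] at ht⟩)
    refine intervalIntegral.integral_eq_sub_of_hasDerivAt
      (f := fun t => f (i.insertNth (α := fun _ => ℝ) t y)) (fun t ht => ?_) ?_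
    · have hd : DifferentiableAt ℝ f (i.insertNth (α := fun _ => ℝ) t y) :=
        ((hf.differentiableOn (by simp)) _ (hmem t ht)).differentiableAt
          (hU.mem_nhds (hmem t ht))
      exact hd.hasFDerivAt.comp_hasDerivAt t (hasDerivAt_insertNth i y t)
    · refine ContinuousOn.intervalIntegrable ?_
      exact hc.comp ((continuous_insertNth i).comp
        (continuous_id.prodMk continuous_const)).continuousOn hmem
  · refine ContinuousOn.integrableOn_compact (isCompact_TSimplex k) ?_
    exact hf.continuousOn.comp ((continuous_insertNth i).comp
      (Continuous.prodMk (by fun_prop) continuous_id)).continuousOn fun y hy =>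
        hs ((insertNth_mem_TSimplex_iff i _ y).mpr
          ⟨hy, sum_nonneg_of_mem_TSimplex hy, le_rfl⟩)
  · refine ContinuousOn.integrableOn_compact (isCompact_TSimplex k) ?_
    exact hf.continuousOn.comp ((continuous_insertNth i).comp
      (Continuous.prodMk continuous_const continuous_id)).continuousOn fun y hy =>
        hs ((insertNth_mem_TSimplex_iff i _ y).mpr
          ⟨hy, le_rfl, sum_nonneg_of_mem_TSimplex hy⟩)

/-- The affine involution of `Δ^k` exchanging the `0`-th and `(i+1)`-st vertices. -/
def swapVertex {k : ℕ} (i : Fin k) (x : Fin k → ℝ) : Fin k → ℝ :=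
  Function.update x i (1 - ∑ j, x j)

theorem sum_update_eq {k : ℕ} (i : Fin k) (x : Fin k → ℝ) (a : ℝ) :
    ∑ j, Function.update x i a j = a + ∑ j, x j - x i := by
  rw [Finset.sum_update_of_mem (Finset.mem_univ i),
    ← Finset.add_sum_erase _ x (Finset.mem_univ i), Finset.sdiff_singleton_eq_erase]
  ring

theorem one_sub_sum_swapVertex {k : ℕ} (i : Fin k) (x : Fin k → ℝ) :
    1 - ∑ j, swapVertex i x j = x i := by
  rw [swapVertex, sum_update_eq]
  ring

theorem swapVertex_involutive {k : ℕ} (i : Fin k) : Function.Involutive (swapVertex i) := by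
  intro x
  rw [swapVertex, one_sub_sum_swapVertex, swapVertex, Function.update_idem,
    Function.update_eq_self]

theorem swapVertex_mem {k : ℕ} (i : Fin k) {x : Fin k → ℝ} (hx : x ∈ TSimplex k) :
    swapVertex i x ∈ TSimplex k := by
  refine ⟨fun j => ?_, ?_⟩
  · rcases eq_or_ne j i with rfl | h
    · simpa [swapVertex] using hx.2
    · simpa [swapVertex, h] using hx.1 j
  · have := one_sub_sum_swapVertex i x
    have := hx.1 i
    linarith

theorem swapVertex_preimage {k : ℕ} (i : Fin k) :
    swapVertex i ⁻¹' TSimplex k = TSimplex k := by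
  ext x
  refine ⟨fun h => ?_, swapVertex_mem i⟩
  simpa [swapVertex_involutive i x] using swapVertex_mem i h

theorem measurePreserving_swapVertex {k : ℕ} (i : Fin k) :
    MeasurePreserving (swapVertex i) := by
  let L : (Fin k → ℝ) →ₗ[ℝ] (Fin k → ℝ) :=
    { toFun := fun x => Function.update x i (-∑ j, x j)
      map_add' := fun x y => by
        ext j
        rcases eq_or_ne j i with rfl | h
        · simp [Finset.sum_add_distrib, add_comm]
        · simp [h]
      map_smul' := fun c x => by
        ext j
        rcases eq_or_ne j i with rfl | h
        · simp [Finset.mul_sum]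
        · simp [h] }
  have hL : L ∘ₗ L = LinearMap.id := by
    ext1 j
    ext1
    have h : L (L (Pi.single j 1)) = Pi.single j 1 := by
      change Function.update (Function.update _ i _) i
        (-∑ j, Function.update _ i _ j) = _
      rw [sum_update_eq, Function.update_idem]
      simp
    simpa using h
  have hdet : LinearMap.det L * LinearMap.det L = 1 := by
    rw [← LinearMap.det_comp, hL, LinearMap.det_id]
  have habs : |(LinearMap.det L)⁻¹| = 1 := by
    rcases mul_self_eq_one_iff.mp hdet with h | h <;> simp [h]
  have h0 : LinearMap.det L ≠ 0 := fun h => by simp [h] at hdet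
  have hmpL : MeasurePreserving L :=
    ⟨L.continuous_of_finiteDimensional.measurable, by
      rw [Measure.map_linearMap_addHaar_eq_smul_addHaar _ h0, habs]
      simp⟩
  have heq : swapVertex i = (fun x => Pi.single i 1 + x) ∘ L := by
    funext x j
    change Function.update x i _ j = (Pi.single i 1 : Fin k → ℝ) j + Function.update x i _ j
    rcases eq_or_ne j i with rfl | h
    · simp [sub_eq_add_neg]
    · simp [h]
  rw [heq]
  exact (measurePreserving_add_left volume (Pi.single i 1)).comp hmpL

theorem insertNth_castSucc_swapVertex {k : ℕ} (i : Fin k) (x : Fin k → ℝ) :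
    i.castSucc.insertNth (α := fun _ => ℝ) (1 - ∑ j, swapVertex i x j) (swapVertex i x) =
      i.succ.insertNth (α := fun _ => ℝ) (1 - ∑ j, x j) x := by
  rw [one_sub_sum_swapVertex]
  symm
  rw [Fin.insertNth_eq_iff]
  constructor
  · have : i.castSucc.succAbove i = i.succ := Fin.succAbove_castSucc_self i
    rw [← this, Fin.insertNth_apply_succAbove]
    simp [swapVertex]
  · funext j
    rw [Fin.removeNth_apply]
    rcases lt_trichotomy j i with h | rfl | h
    · have e : i.succ.succAbove j = i.castSucc.succAbove j := by
        rw [Fin.succAbove_of_castSucc_lt _ _ (Fin.castSucc_lt_succ_iff.mpr h.le),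
          Fin.succAbove_of_castSucc_lt _ _ (Fin.castSucc_lt_castSucc_iff.mpr h)]
      rw [e, Fin.insertNth_apply_succAbove]
      simp [swapVertex, h.ne]
    · have e : j.succ.succAbove j = j.castSucc := Fin.succAbove_succ_self j
      rw [e, Fin.insertNth_apply_same]
    · have e : i.succ.succAbove j = i.castSucc.succAbove j := by
        rw [Fin.succAbove_of_le_castSucc _ _ (Fin.succ_le_castSucc_iff.mpr h),
          Fin.succAbove_of_le_castSucc _ _ (Fin.castSucc_le_castSucc_iff.mpr h.le)]
      rw [e, Fin.insertNth_apply_succAbove]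
      simp [swapVertex, h.ne']

/-- All the coordinate parametrizations of the face opposite to the origin induce the same measure
on it. -/
theorem setIntegral_TSimplex_slantedFace {k : ℕ} (i : Fin (k + 1))
    (h : (Fin (k + 1) → ℝ) → ℝ) :
    ∫ y in TSimplex k, h (i.insertNth (1 - ∑ j, y j) y) =
      ∫ y in TSimplex k, h (Fin.cons (1 - ∑ j, y j) y) := by
  induction i using Fin.induction with
  | zero => simp [Fin.insertNth_zero']
  | succ i ih =>
    have hcv := (measurePreserving_swapVertex i).setIntegral_preimage_emb
      (MeasurableEquiv.measurableEmbedding (MeasurableEquiv.ofInvolutive _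
        (swapVertex_involutive i) (measurePreserving_swapVertex i).measurable))
      (fun y => h (i.castSucc.insertNth (1 - ∑ j, y j) y)) (TSimplex k)
    rw [← ih, ← hcv, swapVertex_preimage]
    simp only [insertNth_castSucc_swapVertex]

theorem sum_filter_faceHom_zero {k : ℕ} (c : ℝ) (w : Fin k → ℝ) (j : Fin (k + 1)) :
    ∑ l ∈ Finset.univ.filter (fun l => faceHom (0 : Fin (k + 2)) l = j.succ),
      (Fin.cons c w : Fin (k + 1) → ℝ) l = (Fin.cons c w : Fin (k + 1) → ℝ) j := by
  simp [faceHom, Finset.sum_filter]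

theorem sum_filter_faceHom_succ {k : ℕ} (i : Fin (k + 1)) (c : ℝ) (w : Fin k → ℝ)
    (j : Fin (k + 1)) :
    ∑ l ∈ Finset.univ.filter (fun l => faceHom i.succ l = j.succ),
      (Fin.cons c w : Fin (k + 1) → ℝ) l = i.insertNth (α := fun _ => ℝ) 0 w j := by
  rw [Finset.sum_filter, Fin.sum_univ_succ]
  revert j
  rw [Fin.forall_iff_succAbove i]
  refine ⟨?_, fun j => ?_⟩
  · simp [faceHom, Fin.succ_succAbove_succ, Fin.succAbove_ne, (Fin.succ_ne_zero _).symm]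
  · simp [faceHom, Fin.succ_succAbove_succ, (Fin.succ_ne_zero _).symm]

theorem affineAux_faceHom_zero {k : ℕ} (x : Fin k → ℝ) :
    affineAux (faceHom (0 : Fin (k + 2))) x = Fin.cons (1 - ∑ j, x j) x :=
  funext fun j => sum_filter_faceHom_zero _ x j

theorem affineAux_faceHom_succ {k : ℕ} (i : Fin (k + 1)) (x : Fin k → ℝ) :
    affineAux (faceHom i.succ) x = i.insertNth 0 x :=
  funext fun j => sum_filter_faceHom_succ i _ x j

theorem fderiv_affineAux_apply {m n : ℕ} (φ : Fin (m + 1) →o Fin (n + 1)) (x v : Fin m → ℝ)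
    (j : Fin n) :
    fderiv ℝ (affineAux φ) x v j = ∑ i ∈ Finset.univ.filter (fun i => φ i = j.succ),
      (Fin.cons (-∑ l, v l) v : Fin (m + 1) → ℝ) i := by
  let D : Fin (m + 1) → ((Fin m → ℝ) →L[ℝ] ℝ) :=
    Fin.cons (-∑ l, ContinuousLinearMap.proj l) fun l => ContinuousLinearMap.proj l
  have hD : ∀ i, HasFDerivAt (fun x : Fin m → ℝ => bary x i) (D i) x := by
    intro i
    induction i using Fin.cases with
    | zero =>
      exact (HasFDerivAt.fun_sum fun l _ => (hasFDerivAt_apply l x)).const_sub 1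
    | succ l => exact hasFDerivAt_apply l x
  have h : HasFDerivAt (affineAux φ) (ContinuousLinearMap.pi fun j =>
      ∑ i ∈ Finset.univ.filter (fun i => φ i = j.succ), D i) x :=
    hasFDerivAt_pi.mpr fun j => HasFDerivAt.fun_sum fun i _ => hD i
  rw [h.fderiv, ContinuousLinearMap.pi_apply, sum_apply]
  refine Finset.sum_congr rfl fun i _ => ?_
  induction i using Fin.cases <;> simp [D]

theorem fderiv_affineAux_faceHom_zero {k : ℕ} (x : Fin k → ℝ) (l : Fin k) :
    fderiv ℝ (affineAux (faceHom (0 : Fin (k + 2)))) x (Pi.single l 1) =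
      Pi.single l.succ 1 - Pi.single 0 1 := by
  funext j
  rw [fderiv_affineAux_apply, sum_filter_faceHom_zero]
  induction j using Fin.cases with
  | zero => simp
  | succ j => simp [Pi.single_apply]

theorem fderiv_affineAux_faceHom_succ {k : ℕ} (i : Fin (k + 1)) (x : Fin k → ℝ) (l : Fin k) :
    fderiv ℝ (affineAux (faceHom i.succ)) x (Pi.single l 1) =
      Pi.single (i.succAbove l) 1 := by
  funext j
  rw [fderiv_affineAux_apply, sum_filter_faceHom_succ]
  revert j
  rw [Fin.forall_iff_succAbove i]
  refine ⟨?_, fun j => ?_⟩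
  · simp [(Fin.succAbove_ne i l).symm]
  · simp [Pi.single_apply]

theorem faceHom_injective {m : ℕ} (i : Fin (m + 2)) : Function.Injective (faceHom i) :=
  Fin.succAbove_right_injective

/-- An alternating map evaluated on the edge vectors of the face opposite to `v 0`, expanded in
terms of its values on the tuples `v` with one entry omitted. -/
theorem AlternatingMap.map_succ_sub_zero {R M : Type*} [CommRing R] [AddCommGroup M] [Module R M]
    {k : ℕ} (f : M [⋀^Fin k]→ₗ[R] R) (φ : M →ₗ[R] R) (v : Fin (k + 1) → M)
    (hφ : ∀ i, φ (v i) = 1) :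
    f (fun l => v l.succ - v 0) =
      ∑ i : Fin (k + 1), (-1 : R) ^ (i : ℕ) * f (fun l => v (i.succAbove l)) := by
  let W : M [⋀^Fin (k + 1)]→ₗ[R] R := AlternatingMap.alternatizeUncurryFin (φ.smulRight f)
  have hW : ∀ u, W u = ∑ i : Fin (k + 1), (-1 : R) ^ (i : ℕ) * (φ (u i) * f (i.removeNth u)) :=
    fun u => by simp [W, AlternatingMap.alternatizeUncurryFin_apply]
  have h1 : W v = ∑ i : Fin (k + 1), (-1 : R) ^ (i : ℕ) * f (fun l => v (i.succAbove l)) := by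
    rw [hW]
    refine Finset.sum_congr rfl fun i _ => ?_
    rw [hφ, one_mul]
    rfl
  have h2 : W (Fin.cons (v 0) fun l => v l.succ - v 0) = f (fun l => v l.succ - v 0) := by
    rw [hW, Fin.sum_univ_succ, Finset.sum_eq_zero]
    · simp [hφ, Fin.removeNth_zero]
    · intro i _
      simp [hφ]
  have h3 : W (Fin.cons (v 0) fun l => v l.succ - v 0) = W v := by
    have key := (W.curryLeft (v 0)).toMultilinearMap.map_add_univ
      (fun l => v l.succ) (fun _ => -v 0)
    rw [Finset.sum_eq_single Finset.univ] at key
    · rw [Finset.piecewise_univ] at key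
      have e : (Fin.cons (v 0) fun l : Fin k => v l.succ) = v := Fin.cons_self_tail v
      rw [← e]
      simpa [Pi.add_def, sub_eq_add_neg, Matrix.vecCons] using key
    · intro s _ hs
      obtain ⟨l, hl⟩ : ∃ l, l ∉ s := by
        by_contra! h
        exact hs (Finset.eq_univ_of_forall h)
      have hz : W (Function.update (Matrix.vecCons (v 0)
          (s.piecewise (fun l => v l.succ) fun _ => -v 0)) l.succ (v 0)) = 0 :=
        W.map_eq_zero_of_eq _ (i := 0) (j := l.succ) (by simp [Function.update_of_ne (Fin.succ_ne_zero l).symm])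
          (Fin.succ_ne_zero l).symm
      have hn := W.map_update_neg (Matrix.vecCons (v 0)
          (s.piecewise (fun l => v l.succ) fun _ => -v 0)) l.succ (v 0)
      rw [hz, neg_zero] at hn
      rw [← hn]
      change W _ = W _
      congr 1
      symm
      rw [Function.update_eq_iff]
      exact ⟨by simp [hl], fun _ _ => rfl⟩
    · simp
  rw [← h2, h3, h1]

namespace SimpForm

variable {X : SmoothSSet} {k : ℕ}

/-- The value of a simplicial form at a point, as an alternating map. -/
def toAlternating (ω : SimpForm X k) {d : ℕ} (S : X.obj d) (x : Fin d → ℝ) :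
    (Fin d → ℝ) [⋀^Fin k]→ₗ[ℝ] ℝ :=
  { (ω.form d S x).toMultilinearMap with
    map_eq_zero_of_eq' := fun v i j h hij => ω.alternating d S x v i j hij h }

theorem continuousOn_apply (ω : SimpForm X k) {d : ℕ} (S : X.obj d) (v : Fin k → Fin d → ℝ) :
    ContinuousOn (fun x => ω.form d S x v) (TSimplex d) := by
  obtain ⟨U, -, hs, hf⟩ := ω.smooth d S
  let ev := ContinuousMultilinearMap.apply ℝ (fun _ : Fin k => Fin d → ℝ) ℝ v
  exact ev.continuous.comp_continuousOn (hf.continuousOn.mono hs)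

theorem integrableOn_apply (ω : SimpForm X k) {d : ℕ} (S : X.obj d) (v : Fin k → Fin d → ℝ) :
    IntegrableOn (fun x => ω.form d S x v) (TSimplex d) :=
  (ω.continuousOn_apply S v).integrableOn_compact (isCompact_TSimplex d)

theorem integCochain_faceHom_succ (ω : SimpForm X k) (S : X.obj (k + 1)) (i : Fin (k + 1)) :
    integCochain X k ω (X.map k (k + 1) (faceHom i.succ) S) =
      ∫ y in TSimplex k, ω.form (k + 1) S (i.insertNth 0 y)
        (fun l => Pi.single (i.succAbove l) 1) := by
  refine setIntegral_congr_fun (isClosed_TSimplex k).measurableSet fun y hy => ?_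
  simp only [ω.compat k (k + 1) _ (faceHom_injective i.succ) S y hy, affineAux_faceHom_succ,
    fderiv_affineAux_faceHom_succ]

theorem integCochain_faceHom_zero (ω : SimpForm X k) (S : X.obj (k + 1)) :
    integCochain X k ω (X.map k (k + 1) (faceHom 0) S) =
      ∑ i : Fin (k + 1), (-1 : ℝ) ^ (i : ℕ) *
        ∫ y in TSimplex k, ω.form (k + 1) S (i.insertNth (1 - ∑ j, y j) y)
          (fun l => Pi.single (i.succAbove l) 1) := by
  have hpt : ∀ y ∈ TSimplex k,
      ω.form k (X.map k (k + 1) (faceHom 0) S) y (fun l => Pi.single l 1) =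
        ∑ i : Fin (k + 1), (-1 : ℝ) ^ (i : ℕ) *
          ω.form (k + 1) S (Fin.cons (1 - ∑ j, y j) y)
            (fun l => Pi.single (i.succAbove l) 1) := by
    intro y hy
    simp only [ω.compat k (k + 1) _ (faceHom_injective 0) S y hy, affineAux_faceHom_zero,
      fderiv_affineAux_faceHom_zero]
    exact (ω.toAlternating S (Fin.cons (1 - ∑ j, y j) y)).map_succ_sub_zero
      (∑ j, LinearMap.proj j) (fun i => Pi.single i 1) (fun i => by simp)
  rw [integCochain, setIntegral_congr_fun (isClosed_TSimplex k).measurableSet hpt,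
    integral_finsetSum]
  · refine Finset.sum_congr rfl fun i _ => ?_
    rw [integral_const_mul, setIntegral_TSimplex_slantedFace i fun x =>
      ω.form (k + 1) S x (fun l => Pi.single (i.succAbove l) 1)]
  · intro i _
    refine Integrable.const_mul ?_ _
    refine ContinuousOn.integrableOn_compact (isCompact_TSimplex k) ?_
    refine (ω.continuousOn_apply S _).comp (Continuous.continuousOn ?_) fun y hy => ?_
    · exact Continuous.finCons (by fun_prop) continuous_id
    · rw [← Fin.insertNth_zero']
      exact (insertNth_mem_TSimplex_iff 0 _ y).mpr
        ⟨hy, sum_nonneg_of_mem_TSimplex hy, le_rfl⟩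

/-- Stokes' theorem on a single simplex. -/
theorem integral_extDerEval (ω : SimpForm X k) (S : X.obj (k + 1)) :
    (∫ x in TSimplex (k + 1),
        extDerEval (ω.form (k + 1) S) x (fun i : Fin (k + 1) => Pi.single i 1)) =
      cobdry X k (integCochain X k ω) S := by
  obtain ⟨U, hU, hs, hω⟩ := ω.smooth (k + 1) S
  let f : Fin (k + 1) → (Fin (k + 1) → ℝ) → ℝ := fun i x =>
    ω.form (k + 1) S x (fun l => Pi.single (i.succAbove l) 1)
  let ev : Fin (k + 1) → ((Fin (k + 1) → ℝ) [×k]→L[ℝ] ℝ) →L[ℝ] ℝ := fun i =>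
    ContinuousMultilinearMap.apply ℝ (fun _ : Fin k => Fin (k + 1) → ℝ) ℝ
      (fun l => Pi.single (i.succAbove l) 1)
  have hf : ∀ i, ContDiffOn ℝ (⊤ : ℕ∞) (f i) U := fun i =>
    (ev i).contDiff.comp_contDiffOn hω
  have hpt : ∀ x ∈ TSimplex (k + 1),
      extDerEval (ω.form (k + 1) S) x (fun i : Fin (k + 1) => Pi.single i 1) =
        ∑ i : Fin (k + 1), (-1 : ℝ) ^ (i : ℕ) * fderiv ℝ (f i) x (Pi.single i 1) := by
    intro x hx
    refine Finset.sum_congr rfl fun i _ => ?_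
    have hd : DifferentiableAt ℝ (ω.form (k + 1) S) x :=
      (hω.differentiableOn (by simp) x (hs hx)).differentiableAt (hU.mem_nhds (hs hx))
    have h := (ev i).hasFDerivAt.comp x hd.hasFDerivAt
    rw [show f i = ev i ∘ ω.form (k + 1) S from rfl, h.fderiv]
    rfl
  rw [setIntegral_congr_fun (isClosed_TSimplex (k + 1)).measurableSet hpt, integral_finsetSum]
  · rw [cobdry, Fin.sum_univ_succ (n := k + 1), integCochain_faceHom_zero]
    simp only [integCochain_faceHom_succ, integral_const_mul,
      setIntegral_TSimplex_fderiv _ hU hs (hf _), f]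
    rw [Fin.val_zero, pow_zero, one_mul, ← Finset.sum_add_distrib]
    refine Finset.sum_congr rfl fun i _ => ?_
    rw [Fin.val_succ]
    ring
  · intro i _
    exact Integrable.const_mul (((continuousOn_fderiv_apply hU (hf i) _).mono
      hs).integrableOn_compact (isCompact_TSimplex (k + 1))) _

end SimpForm

/-- Let `X` be a smooth simplicial set.  The integration map
`∫ : Ω^k(X) → C^k(X; ℝ)` commutes with the differentials, `∫(dω) = d(∫ω)`; consequently
it sends closed forms to cocycles and exact forms to coboundaries, and descends to
cohomology, inducing a homomorphism `H^k_DR(X) → H^k(X; ℝ)`. -/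
theorem integration_commutes_with_d (X : SmoothSSet) (k : ℕ) :
    -- `∫ (dω) = d (∫ ω)` as `(k+1)`-cochains:
    (∀ (ω : SimpForm X k) (S : X.obj (k + 1)),
        (∫ x in TSimplex (k + 1),
            extDerEval (ω.form (k + 1) S) x (fun i : Fin (k + 1) => Pi.single i 1)) =
        cobdry X k (integCochain X k ω) S) ∧
    -- closed forms are sent to cocycles:
    (∀ ω : SimpForm X k, FormClosed ω → cobdry X k (integCochain X k ω) = 0) ∧
    -- exact forms are sent to coboundaries:
    (∀ (η : SimpForm X k) (ω : SimpForm X (k + 1)), FormDeriv η ω →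
        ∃ α : X.obj k → ℝ, integCochain X (k + 1) ω = cobdry X k α) ∧
    -- hence integration descends to a well-defined map on cohomology classes,
    -- inducing `H^{k+1}_DR(X) → H^{k+1}(X; ℝ)`:
    (∀ ω ω' : SimpForm X (k + 1), FormClosed ω → FormClosed ω' →
        (∃ η : SimpForm X k, ∀ (d : ℕ) (S : X.obj d) (x : Fin d → ℝ), x ∈ TSimplex d →
            ∀ v : Fin (k + 1) → (Fin d → ℝ),
              ω.form d S x v - ω'.form d S x v = extDerEval (η.form d S) x v) →
        ∃ α : X.obj k → ℝ, ∀ S : X.obj (k + 1),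
          integCochain X (k + 1) ω S - integCochain X (k + 1) ω' S = cobdry X k α S) := by
  refine ⟨fun ω S => ω.integral_extDerEval S, fun ω hω => ?_, fun η ω h => ?_,
    fun ω ω' _ _ ⟨η, h⟩ => ?_⟩
  · funext S
    rw [← ω.integral_extDerEval S]
    exact setIntegral_eq_zero_of_forall_eq_zero fun x hx => hω (k + 1) S x hx _
  · refine ⟨integCochain X k η, funext fun S => ?_⟩
    rw [← η.integral_extDerEval S]
    exact setIntegral_congr_fun (isClosed_TSimplex (k + 1)).measurableSet
      fun x hx => h (k + 1) S x hx _
  · refine ⟨integCochain X k η, fun S => ?_⟩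
    rw [← η.integral_extDerEval S, integCochain, integCochain,
      ← integral_sub (ω.integrableOn_apply S _) (ω'.integrableOn_apply S _)]
    exact setIntegral_congr_fun (isClosed_TSimplex (k + 1)).measurableSet
      fun x hx => h (k + 1) S x hx _

end
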